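/- For every finite simple graph G, the arboricity α of G and the degeneracy d of G satisfy α ≤ d ≤ 2α − 1. -/

import Mathlib

/-- The edge set of `G` can be partitioned into `k` forests. -/
def HasForestPartition {V : Type*} (G : SimpleGraph V) (k : ℕ) : Prop :=
  ∃ f : G.edgeSet → Fin k, ∀ i : Fin k,
    (SimpleGraph.fromEdgeSet {e : Sym2 V | ∃ h : e ∈ G.edgeSet, f ⟨e, h⟩ = i}).IsAcyclic

/-- The arboricity of `G` : the minimum number of forests into which the edge set
can be partitioned. -/
noncomputable def arboricity {V : Type*} (G : SimpleGraph V) : ℕ :=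
  sInf {k | HasForestPartition G k}

/-- A graph `G` is `d`-degenerate if every nonempty (induced) subgraph contains a
vertex whose degree within that subgraph is at most `d`. -/
def Degenerate {V : Type*} (G : SimpleGraph V) (d : ℕ) : Prop :=
  ∀ s : Finset V, s.Nonempty → ∃ v ∈ s, {u : V | u ∈ s ∧ G.Adj v u}.ncard ≤ d

/-- The degeneracy of `G` : the minimum `d` such that `G` is `d`-degenerate. -/
noncomputable def degeneracy {V : Type*} (G : SimpleGraph V) : ℕ :=
  sInf {d | Degenerate G d}

theorem acyclic_card_edges_lt {W : Type*} [Fintype W] [Nonempty W] (F : SimpleGraph W)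
    [Fintype F.edgeSet] (hF : F.IsAcyclic) : F.edgeFinset.card + 1 ≤ Fintype.card W := by
  classical
  obtain ⟨T, hFT, -, hT⟩ :=
    (SimpleGraph.connected_top (V := W)).exists_isTree_le_of_le_of_isAcyclic le_top hF
  have h1 := hT.card_edgeFinset
  have h2 : F.edgeFinset.card ≤ T.edgeFinset.card :=
    Finset.card_le_card (SimpleGraph.edgeFinset_mono hFT)
  omega

theorem forest_degenerate {V : Type*} [Fintype V] (G : SimpleGraph V) (k : ℕ)
    (h : HasForestPartition G k) : Degenerate G (2 * k - 1) := by
  classical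
  obtain ⟨f, hf⟩ := h
  intro s hs
  by_contra hcon
  push Not at hcon
  have : Nonempty (↥(s : Set V)) := hs.to_subtype
  set F : Fin k → SimpleGraph (↥(s : Set V)) := fun i =>
    (SimpleGraph.fromEdgeSet {e : Sym2 V | ∃ h : e ∈ G.edgeSet, f ⟨e, h⟩ = i}).induce (s : Set V)
    with hFdef
  have hadj : ∀ (v : ↥(s : Set V)) (u : V) (hu : u ∈ s) (ha : G.Adj v u),
      (F (f ⟨s(v.1, u), ha⟩)).Adj v ⟨u, hu⟩ := by
    intro v u hu ha
    simp only [hFdef, SimpleGraph.comap_adj, SimpleGraph.fromEdgeSet_adj]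
    exact ⟨⟨ha, rfl⟩, ha.ne⟩
  have hdeg : ∀ v : ↥(s : Set V), 2 * k ≤ ∑ i, (F i).degree v := by
    intro v
    have h1 := hcon v v.2
    have h2 : {u : V | u ∈ s ∧ G.Adj v u}.ncard ≤ ∑ i, (F i).degree v := by
      have hsub : {u : V | u ∈ s ∧ G.Adj v u} ⊆
          Subtype.val '' ((Finset.univ.biUnion fun i => (F i).neighborFinset v :
            Finset (↥(s : Set V))) : Set (↥(s : Set V))) := by
        rintro u ⟨hu, ha⟩
        refine ⟨⟨u, hu⟩, ?_, rfl⟩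
        simp only [Finset.coe_biUnion, Set.mem_iUnion, Finset.mem_coe,
          SimpleGraph.mem_neighborFinset]
        exact ⟨_, Finset.mem_univ _, hadj v u hu ha⟩
      refine (Set.ncard_le_ncard hsub (Set.toFinite _)).trans ?_
      refine (Set.ncard_image_le (Set.toFinite _)).trans ?_
      rw [Set.ncard_coe_finset]
      exact Finset.card_biUnion_le
    omega
  have hpos : 0 < k := by
    obtain ⟨v, hv⟩ := hs
    have h1 := hcon v hv
    have h2 : {u : V | u ∈ s ∧ G.Adj v u}.Nonempty := by
      apply Set.nonempty_of_ncard_ne_zero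
      omega
    obtain ⟨u, hu, ha⟩ := h2
    exact (f ⟨s(v, u), ha⟩).pos
  have hsum : ∑ v : ↥(s : Set V), 2 * k ≤ ∑ v, ∑ i, (F i).degree v :=
    Finset.sum_le_sum fun v _ => hdeg v
  rw [Finset.sum_comm] at hsum
  have hle : ∑ i, ∑ v, (F i).degree v ≤ ∑ i : Fin k, 2 * (Fintype.card (↥(s : Set V)) - 1) := by
    refine Finset.sum_le_sum fun i _ => ?_
    rw [SimpleGraph.sum_degrees_eq_twice_card_edges]
    have := acyclic_card_edges_lt (F i) ((hf i).induce _)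
    omega
  have hfin := hsum.trans hle
  simp only [Finset.sum_const, Finset.card_univ, Fintype.card_fin, smul_eq_mul] at hfin
  have hc : 0 < Fintype.card (↥(s : Set V)) := Fintype.card_pos
  obtain ⟨m, hm⟩ : ∃ m, Fintype.card (↥(s : Set V)) = m + 1 := ⟨_, (Nat.succ_pred_eq_of_pos hc).symm⟩
  rw [hm] at hfin
  simp only [Nat.add_sub_cancel] at hfin
  nlinarith

theorem degenerate_rank {V : Type*} [Fintype V] (G : SimpleGraph V) (d : ℕ)
    (h : Degenerate G d) (n : ℕ) : ∀ s : Finset V, s.card = n →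
    ∃ r : V → ℕ, Set.InjOn r s ∧
      ∀ v ∈ s, {u : V | u ∈ s ∧ G.Adj v u ∧ r u < r v}.ncard ≤ d := by
  classical
  induction n with
  | zero =>
    intro s hs
    rw [Finset.card_eq_zero] at hs
    subst hs
    exact ⟨fun _ => 0, by simp, by simp⟩
  | succ n ih =>
    intro s hs
    obtain ⟨v, hv, hd⟩ := h s (Finset.card_pos.mp (by omega))
    obtain ⟨r, hinj, hr⟩ := ih (s.erase v) (by rw [Finset.card_erase_of_mem hv]; omega)
    have hlt : ∀ u, r u < Finset.univ.sup r + 1 := fun u =>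
      Nat.lt_succ_of_le (Finset.le_sup (Finset.mem_univ u))
    refine ⟨Function.update r v (Finset.univ.sup r + 1), ?_, ?_⟩
    · intro a ha b hb hab
      have ha' : a ∈ s := ha
      have hb' : b ∈ s := hb
      by_cases h1 : a = v <;> by_cases h2 : b = v
      · rw [h1, h2]
      · subst h1
        rw [Function.update_self, Function.update_of_ne h2] at hab
        exact absurd hab (hlt b).ne'
      · subst h2
        rw [Function.update_self, Function.update_of_ne h1] at hab
        exact absurd hab (hlt a).ne
      · rw [Function.update_of_ne h1, Function.update_of_ne h2] at hab
        exact hinj (by simp [h1, ha']) (by simp [h2, hb']) hab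
    · intro w hw
      by_cases h1 : w = v
      · subst h1
        refine (Set.ncard_le_ncard ?_ (Set.toFinite _)).trans hd
        rintro u ⟨hu, ha, -⟩
        exact ⟨hu, ha⟩
      · refine (Set.ncard_le_ncard ?_ (Set.toFinite _)).trans (hr w (by simp [h1, hw]))
        rintro u ⟨hu, ha, hl⟩
        rw [Function.update_of_ne h1] at hl
        by_cases h2 : u = v
        · subst h2
          rw [Function.update_self] at hl
          exact absurd hl (hlt w).not_gt
        · rw [Function.update_of_ne h2] at hl
          exact ⟨by simp [h2, hu], ha, hl⟩

theorem acyclic_of_rank {V : Type*} (F : SimpleGraph V) (r : V → ℕ)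
    (hne : ∀ u v, F.Adj u v → r u ≠ r v)
    (huniq : ∀ v a b, F.Adj v a → F.Adj v b → r a < r v → r b < r v → a = b) :
    F.IsAcyclic := by
  classical
  intro x c hc
  obtain ⟨v, hv, hmax⟩ := c.support.toFinset.exists_max_image r ⟨x, by simp⟩
  have hv' : v ∈ c.support := by simpa using hv
  have hc' := hc.rotate (hu := hv')
  have key : ∀ a ∈ (c.rotate v hv').support, F.Adj v a → r a < r v := by
    intro a ha hva
    have ha' : a ∈ c.support := by simpa using ha
    exact lt_of_le_of_ne (hmax a (by simpa using ha')) (hne _ _ hva.symm)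
  have a1 := SimpleGraph.Walk.adj_snd hc'.not_nil
  have a2 := (SimpleGraph.Walk.adj_penultimate hc'.not_nil).symm
  exact hc'.snd_ne_penultimate (huniq v _ _ a1 a2
    (key _ (SimpleGraph.Walk.getVert_mem_support _ _) a1)
    (key _ (SimpleGraph.Walk.getVert_mem_support _ _) a2))

theorem degenerate_forest {V : Type*} [Fintype V] (G : SimpleGraph V) (d : ℕ)
    (h : Degenerate G d) : HasForestPartition G d := by
  classical
  obtain ⟨r, hinj, hr⟩ := degenerate_rank G d h _ Finset.univ rfl
  have hinj' : Function.Injective r := fun a b hab => hinj (by simp) (by simp) hab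
  have hg : ∀ v, Nonempty ({u : V // G.Adj v u ∧ r u < r v} ↪ Fin d) := by
    intro v
    apply Function.Embedding.nonempty_of_card_le
    have := hr v (Finset.mem_univ v)
    simp only [Finset.mem_univ, true_and] at this
    rw [Fintype.card_fin, ← Nat.card_eq_fintype_card]
    exact this
  have g : ∀ v, {u : V // G.Adj v u ∧ r u < r v} ↪ Fin d := fun v => (hg v).some
  have hex : ∀ e : G.edgeSet, ∃ v, ∃ u : {u : V // G.Adj v u ∧ r u < r v}, e.1 = s(v, u.1) := by
    rintro ⟨e, he⟩
    induction e with
    | h a b =>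
      have hab : G.Adj a b := he
      rcases lt_trichotomy (r a) (r b) with hl | hl | hl
      · exact ⟨b, ⟨a, hab.symm, hl⟩, Sym2.eq_swap⟩
      · exact absurd (hinj' hl) hab.ne
      · exact ⟨a, ⟨b, hab, hl⟩, rfl⟩
  choose p q hpq using hex
  refine ⟨fun e => g (p e) (q e), fun i => acyclic_of_rank _ r ?_ ?_⟩
  · intro u v huv hr
    exact huv.ne (hinj' hr)
  · have key : ∀ v a (hva : s(v, a) ∈ G.edgeSet), r a < r v →
        ∃ ha, g (p ⟨_, hva⟩) (q ⟨_, hva⟩) = g v ⟨a, ha⟩ := by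
      intro v a hva hlt
      refine ⟨⟨hva, hlt⟩, ?_⟩
      have aux : ∀ (P : V) (Q : {u : V // G.Adj P u ∧ r u < r P}), s(v, a) = s(P, Q.1) →
          g P Q = g v ⟨a, hva, hlt⟩ := by
        rintro P ⟨Q, hQ⟩ hs
        rw [Sym2.eq_iff] at hs
        rcases hs with ⟨h1, h2⟩ | ⟨h1, h2⟩
        · simp only at h2
          subst h1
          subst h2
          rfl
        · simp only at h1
          subst h1
          subst h2
          exact absurd hlt hQ.2.not_gt
      exact aux _ _ (hpq ⟨_, hva⟩)
    intro v a b ha hb hla hlb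
    rw [SimpleGraph.fromEdgeSet_adj] at ha hb
    obtain ⟨⟨ha, hia⟩, -⟩ := ha
    obtain ⟨⟨hb, hib⟩, -⟩ := hb
    obtain ⟨ha', h1⟩ := key v a ha hla
    obtain ⟨hb', h2⟩ := key v b hb hlb
    have := (g v).injective (h1.symm.trans (hia.trans (hib.symm.trans h2)))
    exact congrArg Subtype.val this

theorem stmt2 {V : Type*} [Fintype V] (G : SimpleGraph V) :
    arboricity G ≤ degeneracy G ∧ degeneracy G ≤ 2 * arboricity G - 1 := by
  have hne : {d | Degenerate G d}.Nonempty := by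
    refine ⟨Nat.card V, fun s hs => ?_⟩
    obtain ⟨v, hv⟩ := hs
    exact ⟨v, hv, Set.ncard_le_card _⟩
  have h1 : HasForestPartition G (degeneracy G) := degenerate_forest G _ (Nat.sInf_mem hne)
  have h2 : HasForestPartition G (arboricity G) :=
    Nat.sInf_mem (s := {k | HasForestPartition G k}) ⟨_, h1⟩
  exact ⟨Nat.sInf_le h1, Nat.sInf_le (forest_degenerate G _ h2)⟩
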